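/- Let x be a cutvertex of a finite connected simple graph G, and let a and b be vertices lying in different components of G − x. Then r(a,b) = r(a,x) + r(x,b). -/

import Mathlib

open scoped Classical

noncomputable section

namespace KfPaper

variable {V : Type*} {W : Type*}

/-- The energy of a potential `f` on graph `G`, viewing each edge as a unit resistor:
`(1/2) · ∑_{x,y adjacent} (f x - f y)²` (each edge counted twice, hence the `1/2`). -/
def energy [Fintype V] (G : SimpleGraph V) (f : V → ℝ) : ℝ :=
  (1 / 2) * ∑ x : V, ∑ y : V, (if G.Adj x y then (f x - f y) ^ 2 else 0)

/-- The resistance distance (effective resistance) between `u` and `v`: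
`r(u,v) = 1 / inf { energy f : f u = 1, f v = 0 }` and `r(u,u) = 0`. -/
def resistanceDistance [Fintype V] (G : SimpleGraph V) (u v : V) : ℝ :=
  if u = v then 0
  else 1 / sInf {e : ℝ | ∃ f : V → ℝ, f u = 1 ∧ f v = 0 ∧ energy G f = e}

/-- The Kirchhoff index: sum of resistance distances over unordered pairs of distinct
vertices (each ordered pair counted once via the factor `1/2`, diagonal terms vanish). -/
def kirchhoffIndex [Fintype V] (G : SimpleGraph V) : ℝ :=
  (1 / 2) * ∑ u : V, ∑ v : V, resistanceDistance G u v

/-- `Kf_v(G) = ∑_{u ≠ v} r(v,u)` (the term `u = v` contributes `0`). -/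
def kirchhoffAt [Fintype V] (G : SimpleGraph V) (v : V) : ℝ :=
  ∑ u : V, resistanceDistance G v u

/-- The Wiener index: sum of graph distances over unordered pairs of distinct vertices. -/
def wienerIndex [Fintype V] (G : SimpleGraph V) : ℝ :=
  (1 / 2) * ∑ u : V, ∑ v : V, (G.dist u v : ℝ)

/-- `W_v(G) = ∑_u d(v,u)`. -/
def wienerAt [Fintype V] (G : SimpleGraph V) (v : V) : ℝ :=
  ∑ u : V, (G.dist v u : ℝ)

/-- The degree of a vertex. -/
def degree' (G : SimpleGraph V) (v : V) : ℕ := Nat.card (G.neighborSet v)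

/-- `G` has maximum degree `Δ`. -/
def HasMaxDegree (G : SimpleGraph V) (Δ : ℕ) : Prop :=
  (∀ v, degree' G v ≤ Δ) ∧ ∃ v, degree' G v = Δ

/-- A unicyclic graph: a connected graph containing exactly one cycle, equivalently a
connected graph with as many edges as vertices. -/
def IsUnicyclic [Fintype V] (G : SimpleGraph V) : Prop :=
  G.Connected ∧ Nat.card G.edgeSet = Fintype.card V

/-- The effective conductance between `u` and `v`: the infimum of the energies of the potentials
equal to `1` at `u` and to `0` at `v`. -/
def conductance [Fintype V] (G : SimpleGraph V) (u v : V) : ℝ :=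
  sInf {e : ℝ | ∃ f : V → ℝ, f u = 1 ∧ f v = 0 ∧ energy G f = e}

section Energy

variable [Fintype V] (G : SimpleGraph V)

lemma resistanceDistance_of_ne {u v : V} (h : u ≠ v) :
    resistanceDistance G u v = 1 / conductance G u v := by
  simp [resistanceDistance, conductance, h]

lemma energy_nonneg (f : V → ℝ) : 0 ≤ energy G f := by
  unfold energy
  have : 0 ≤ ∑ x : V, ∑ y : V, (if G.Adj x y then (f x - f y) ^ 2 else 0) :=
    Finset.sum_nonneg fun x _ => Finset.sum_nonneg fun y _ => by split_ifs <;> positivity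
  positivity

lemma energy_affine (f : V → ℝ) (c d : ℝ) :
    energy G (fun z => c * (f z - d)) = c ^ 2 * energy G f := by
  unfold energy
  simp only [Finset.mul_sum]
  refine Finset.sum_congr rfl fun x _ => Finset.sum_congr rfl fun y _ => ?_
  split_ifs <;> ring

lemma energy_le_of_adj {f g h : V → ℝ} (c d : ℝ)
    (H : ∀ u v, G.Adj u v → (h u - h v) ^ 2 ≤ c * (f u - f v) ^ 2 + d * (g u - g v) ^ 2) :
    energy G h ≤ c * energy G f + d * energy G g := by
  have : ∑ u : V, ∑ v : V, (if G.Adj u v then (h u - h v) ^ 2 else 0) ≤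
      c * ∑ u : V, ∑ v : V, (if G.Adj u v then (f u - f v) ^ 2 else 0) +
      d * ∑ u : V, ∑ v : V, (if G.Adj u v then (g u - g v) ^ 2 else 0) := by
    simp only [Finset.mul_sum, ← Finset.sum_add_distrib]
    refine Finset.sum_le_sum fun u _ => Finset.sum_le_sum fun v _ => ?_
    split_ifs with huv
    · exact H u v huv
    · simp
  unfold energy
  linarith

lemma energy_eq_add_of_adj {f g h : V → ℝ}
    (H : ∀ u v, G.Adj u v → (h u - h v) ^ 2 = (f u - f v) ^ 2 + (g u - g v) ^ 2) :
    energy G h = energy G f + energy G g := by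
  unfold energy
  rw [← mul_add]
  simp only [← Finset.sum_add_distrib]
  congr 1
  refine Finset.sum_congr rfl fun u _ => Finset.sum_congr rfl fun v _ => ?_
  split_ifs with huv
  · exact H u v huv
  · simp

lemma sq_sub_le_energy (f : V → ℝ) {u v : V} (huv : G.Adj u v) :
    (f u - f v) ^ 2 ≤ energy G f := by
  have hnn : ∀ x y, 0 ≤ (if G.Adj x y then (f x - f y) ^ 2 else 0) := fun x y => by
    split_ifs <;> positivity
  have key : ∀ x y, G.Adj x y → (f x - f y) ^ 2 ≤
      ∑ z : V, (if G.Adj x z then (f x - f z) ^ 2 else 0) := fun x y hxy => by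
    have := Finset.single_le_sum (fun z _ => hnn x z) (Finset.mem_univ y)
    simpa [hxy] using this
  have h2 := Finset.add_le_sum
    (f := fun x => ∑ z : V, (if G.Adj x z then (f x - f z) ^ 2 else 0))
    (fun x _ => Finset.sum_nonneg fun z _ => hnn x z)
    (Finset.mem_univ u) (Finset.mem_univ v) huv.ne
  have h3 := key u v huv
  have h4 := key v u huv.symm
  have h5 : (f v - f u) ^ 2 = (f u - f v) ^ 2 := by ring
  unfold energy
  linarith

lemma abs_sub_le_length_mul_sqrt_energy (f : V → ℝ) {u v : V} (p : G.Walk u v) :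
    |f u - f v| ≤ p.length * √(energy G f) := by
  induction p with
  | nil => simp
  | @cons u v w h p ih =>
    have h1 := Real.abs_le_sqrt (sq_sub_le_energy G f h)
    have h2 := abs_sub_le (f u) (f v) (f w)
    rw [SimpleGraph.Walk.length_cons]
    push_cast
    linarith

lemma conductance_bddBelow (u v : V) :
    BddBelow {e : ℝ | ∃ f : V → ℝ, f u = 1 ∧ f v = 0 ∧ energy G f = e} :=
  ⟨0, by rintro _ ⟨f, -, -, rfl⟩; exact energy_nonneg G f⟩

lemma conductance_nonempty {u v : V} (h : u ≠ v) :
    {e : ℝ | ∃ f : V → ℝ, f u = 1 ∧ f v = 0 ∧ energy G f = e}.Nonempty :=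
  ⟨_, Pi.single u 1, by simp, by simp [h.symm], rfl⟩

lemma conductance_le_energy {u v : V} {f : V → ℝ} (hu : f u = 1) (hv : f v = 0) :
    conductance G u v ≤ energy G f :=
  csInf_le (conductance_bddBelow G u v) ⟨f, hu, hv, rfl⟩

lemma le_conductance {u v : V} (h : u ≠ v) {c : ℝ}
    (H : ∀ f : V → ℝ, f u = 1 → f v = 0 → c ≤ energy G f) : c ≤ conductance G u v :=
  le_csInf (conductance_nonempty G h) (by rintro _ ⟨f, hu, hv, rfl⟩; exact H f hu hv)

lemma exists_energy_lt {u v : V} (h : u ≠ v) {ε : ℝ} (hε : 0 < ε) :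
    ∃ f : V → ℝ, f u = 1 ∧ f v = 0 ∧ energy G f < conductance G u v + ε := by
  obtain ⟨_, ⟨f, hu, hv, rfl⟩, hlt⟩ := exists_lt_of_csInf_lt (conductance_nonempty G h)
    (lt_add_of_pos_right (conductance G u v) hε)
  exact ⟨f, hu, hv, hlt⟩

lemma conductance_mul_sq_le_energy (f : V → ℝ) (u v : V) :
    conductance G u v * (f u - f v) ^ 2 ≤ energy G f := by
  by_cases h : f u - f v = 0
  · simpa [h] using energy_nonneg G f
  · have h1 := conductance_le_energy G (u := u) (v := v)
      (f := fun z => (f u - f v)⁻¹ * (f z - f v)) (inv_mul_cancel₀ h) (by simp)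
    rw [energy_affine, inv_pow, inv_mul_eq_div, le_div_iff₀ (by positivity)] at h1
    exact h1

lemma conductance_pos {G : SimpleGraph V} (hG : G.Connected) {u v : V} (h : u ≠ v) :
    0 < conductance G u v := by
  obtain ⟨p⟩ := hG.preconnected u v
  have hn : 0 < (p.length : ℝ) := by
    rw [Nat.cast_pos, Nat.pos_iff_ne_zero]
    exact fun h0 => h (SimpleGraph.Walk.eq_of_length_eq_zero h0)
  refine lt_of_lt_of_le (show 0 < (1 / (p.length : ℝ)) ^ 2 by positivity)
    (le_conductance G h fun f hu hv => ?_)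
  have h1 := abs_sub_le_length_mul_sqrt_energy G f p
  rw [hu, hv, sub_zero, abs_one] at h1
  rw [← Real.le_sqrt (by positivity) (energy_nonneg G f), div_le_iff₀ hn]
  linarith

/-- The series law: if every edge leaving `A` ends at `x ∉ A`, then conductances between a vertex
of `A` and a vertex outside `A` combine in series through `x`. -/
lemma conductance_series {G : SimpleGraph V} (hG : G.Connected) {x a b : V} {A : Set V}
    (hA : ∀ u v, G.Adj u v → u ∈ A → v ∉ A → v = x) (hx : x ∉ A) (ha : a ∈ A) (hb : b ∉ A)
    (hbx : x ≠ b) :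
    conductance G a b =
      conductance G a x * conductance G x b / (conductance G a x + conductance G x b) := by
  have hax : a ≠ x := fun h => hx (h ▸ ha)
  have hab : a ≠ b := fun h => hb (h ▸ ha)
  have hp := conductance_pos hG hax
  have hq := conductance_pos hG hbx
  set p := conductance G a x
  set q := conductance G x b
  apply le_antisymm
  · have hs : p * q / (p + q) = (1 - p / (p + q)) ^ 2 * p + (p / (p + q)) ^ 2 * q := by
      field_simp
      ring
    have hs0 : 0 ≤ p / (p + q) := by positivity
    have hs1 : p / (p + q) ≤ 1 := by rw [div_le_one (by positivity)]; linarith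
    rw [hs]
    set s := p / (p + q)
    refine le_of_forall_pos_le_add fun ε hε => ?_
    obtain ⟨f, hfa, hfx, hf⟩ := exists_energy_lt G hax (half_pos hε)
    obtain ⟨g, hgx, hgb, hg⟩ := exists_energy_lt G hbx (half_pos hε)
    have h1 := conductance_le_energy G (u := a) (v := b)
      (f := fun z => if z ∈ A then s + (1 - s) * f z else s * g z) (by simp [ha, hfa])
      (by simp [hb, hgb])
    have h2 : energy G (fun z => if z ∈ A then s + (1 - s) * f z else s * g z) ≤
        (1 - s) ^ 2 * energy G f + s ^ 2 * energy G g := by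
      refine energy_le_of_adj G _ _ fun u v huv => ?_
      by_cases hu : u ∈ A <;> by_cases hv : v ∈ A
      · simp only [hu, hv, if_true]
        nlinarith [mul_nonneg (sq_nonneg s) (sq_nonneg (g u - g v))]
      · obtain rfl := hA u v huv hu hv
        simp only [hu, hv, if_true, if_false, hgx, hfx]
        nlinarith [mul_nonneg (sq_nonneg s) (sq_nonneg (g u - 1))]
      · obtain rfl := hA v u huv.symm hv hu
        simp only [hu, hv, if_true, if_false, hgx, hfx]
        nlinarith [mul_nonneg (sq_nonneg s) (sq_nonneg (1 - g v))]
      · simp only [hu, hv, if_false]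
        nlinarith [mul_nonneg (sq_nonneg (1 - s)) (sq_nonneg (f u - f v))]
    have h3 : (1 - s) ^ 2 * energy G f ≤ (1 - s) ^ 2 * (p + ε / 2) := by gcongr
    have h4 : s ^ 2 * energy G g ≤ s ^ 2 * (q + ε / 2) := by gcongr
    have h5 : (1 - s) ^ 2 ≤ 1 := by nlinarith
    have h6 : s ^ 2 ≤ 1 := by nlinarith
    nlinarith
  · refine le_conductance G hab fun f hfa hfb => ?_
    have h : energy G f = energy G (fun z => if z ∈ A then f z else f x) +
        energy G (fun z => if z ∈ A then f x else f z) := by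
      refine energy_eq_add_of_adj G fun u v huv => ?_
      by_cases hu : u ∈ A <;> by_cases hv : v ∈ A
      · simp [hu, hv]
      · obtain rfl := hA u v huv hu hv
        simp [hu, hv]
      · obtain rfl := hA v u huv.symm hv hu
        simp [hu, hv]
      · simp [hu, hv]
    have h1 := conductance_mul_sq_le_energy G (fun z => if z ∈ A then f z else f x) a x
    have h2 := conductance_mul_sq_le_energy G (fun z => if z ∈ A then f x else f z) x b
    simp only [ha, hx, hb, if_true, if_false, hfa, hfb] at h1 h2
    change p * _ ≤ _ at h1
    change q * _ ≤ _ at h2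
    rw [div_le_iff₀ (by positivity), h]
    nlinarith [sq_nonneg (p * (1 - f x) - q * f x)]

end Energy

/-- If `x` is a cutvertex of a connected graph `G` and `a`, `b` lie in different components
of `G − x`, then `r(a,b) = r(a,x) + r(x,b)`. -/
theorem statement1 [Fintype V] (G : SimpleGraph V) (hconn : G.Connected) (x : V)
    (hcut : ¬ (G.induce ({x}ᶜ : Set V)).Connected)
    (a b : ({x}ᶜ : Set V))
    (hab : ¬ (G.induce ({x}ᶜ : Set V)).Reachable a b) :
    resistanceDistance G a.val b.val
      = resistanceDistance G a.val x + resistanceDistance G x b.val := by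
  have hax : a.val ≠ x := a.2
  have hxb : x ≠ b.val := Ne.symm b.2
  let A : Set V := {v | ∃ h : v ∈ ({x}ᶜ : Set V), (G.induce ({x}ᶜ : Set V)).Reachable a ⟨v, h⟩}
  have hA : ∀ u v, G.Adj u v → u ∈ A → v ∉ A → v = x := by
    rintro u v huv ⟨hu, hr⟩ hv
    by_contra hvx
    refine hv ⟨hvx, hr.trans (SimpleGraph.Adj.reachable ?_)⟩
    simpa using huv
  have hx : x ∉ A := fun ⟨h, _⟩ => h rfl
  have ha : a.val ∈ A := ⟨a.2, SimpleGraph.Reachable.refl _⟩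
  have hb : b.val ∉ A := fun ⟨_, h⟩ => hab h
  have hne : a.val ≠ b.val := fun h => hb (h ▸ ha)
  have hp := conductance_pos hconn hax
  have hq := conductance_pos hconn hxb
  rw [resistanceDistance_of_ne G hne, resistanceDistance_of_ne G hax,
    resistanceDistance_of_ne G hxb, conductance_series hconn hA hx ha hb hxb]
  field_simp
  ring

end KfPaper
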